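/- Let (A, α_A) be a finite-dimensional Hom-bialgebra and (H, α_H) a Hom-bialgebra over a field k, let Φ : H⊗A → A⊗H be a Hom-entwining map, and let φ : A*⊗H → H⊗A* be the associated Hom-cotwistor φ(f⊗h) = Σ_i f((e_i)_Φ) h^Φ ⊗ e^i (for dual bases (e_i) of A and (e^i) of A*). Then (H,A,Φ) is a Hom-monoidal entwining datum (i.e. Φ satisfies (E5) and (E6)) if and only if φ is a monoidal Hom-cotwistor (i.e. φ satisfies (M5) and (M6)) between the Hom-bialgebras A*^cop and H. -/

import Mathlib

open TensorProduct BigOperators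

noncomputable section

variable (k : Type*) [Field k]

section HomDefs

variable {A B C H U X Y Z : Type*}
variable [AddCommGroup A] [Module k A] [AddCommGroup B] [Module k B]
variable [AddCommGroup C] [Module k C] [AddCommGroup H] [Module k H]
variable [AddCommGroup U] [Module k U] [AddCommGroup X] [Module k X]
variable [AddCommGroup Y] [Module k Y] [AddCommGroup Z] [Module k Z]

/-- A Hom-algebra `(A, α, μ, e)` over `k`. -/
def IsHomAlgebra (α : A ≃ₗ[k] A) (μ : A →ₗ[k] A →ₗ[k] A) (e : A) : Prop :=
  (∀ a b, α (μ a b) = μ (α a) (α b)) ∧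
  (∀ a b c, μ (α a) (μ b c) = μ (μ a b) (α c)) ∧
  α e = e ∧ (∀ a, μ e a = α a) ∧ (∀ a, μ a e = α a)

/-- A Hom-coalgebra `(C, α, Δ, ε)` over `k`. -/
def IsHomCoalgebra (α : C ≃ₗ[k] C) (Δ : C →ₗ[k] C ⊗[k] C) (ε : C →ₗ[k] k) : Prop :=
  (∀ c, Δ (α c) = TensorProduct.map α.toLinearMap α.toLinearMap (Δ c)) ∧
  (∀ c, ε (α c) = ε c) ∧
  (∀ c, TensorProduct.map α.toLinearMap Δ (Δ c)
      = TensorProduct.assoc k C C C (TensorProduct.map Δ α.toLinearMap (Δ c))) ∧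
  (∀ c, TensorProduct.lid k C (TensorProduct.map ε (LinearMap.id : C →ₗ[k] C) (Δ c)) = α c) ∧
  (∀ c, TensorProduct.rid k C (TensorProduct.map (LinearMap.id : C →ₗ[k] C) ε (Δ c)) = α c)

/-- A Hom-bialgebra `(H, α, μ, e, Δ, ε)` over `k`. -/
def IsHomBialgebra (α : H ≃ₗ[k] H) (μ : H →ₗ[k] H →ₗ[k] H) (e : H)
    (Δ : H →ₗ[k] H ⊗[k] H) (ε : H →ₗ[k] k) : Prop :=
  IsHomAlgebra k α μ e ∧ IsHomCoalgebra k α Δ ε ∧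
  (∀ a b, Δ (μ a b) = TensorProduct.map (TensorProduct.lift μ) (TensorProduct.lift μ)
      (TensorProduct.tensorTensorTensorComm k H H H H (Δ a ⊗ₜ[k] Δ b))) ∧
  Δ e = e ⊗ₜ[k] e ∧
  (∀ a b, ε (μ a b) = ε a * ε b) ∧
  ε e = 1

/-- A right `A`-Hom-module `(U, αU, act)`. -/
def IsHomModule (αA : A ≃ₗ[k] A) (μ : A →ₗ[k] A →ₗ[k] A) (e : A)
    (αU : U ≃ₗ[k] U) (act : U →ₗ[k] A →ₗ[k] U) : Prop :=
  (∀ u a, αU (act u a) = act (αU u) (αA a)) ∧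
  (∀ u, act u e = αU u) ∧
  (∀ u a b, act (act u a) (αA b) = act (αU u) (μ a b))

/-- A right `H`-Hom-comodule `(U, αU, ρ)`. -/
def IsHomComodule (αH : H ≃ₗ[k] H) (Δ : H →ₗ[k] H ⊗[k] H) (ε : H →ₗ[k] k)
    (αU : U ≃ₗ[k] U) (ρ : U →ₗ[k] U ⊗[k] H) : Prop :=
  (∀ u, ρ (αU u) = TensorProduct.map αU.toLinearMap αH.toLinearMap (ρ u)) ∧
  (∀ u, TensorProduct.map αU.toLinearMap Δ (ρ u)
      = TensorProduct.assoc k U H H (TensorProduct.map ρ αH.toLinearMap (ρ u))) ∧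
  (∀ u, TensorProduct.rid k U (TensorProduct.map (LinearMap.id : U →ₗ[k] U) ε (ρ u)) = αU u)

/-- A Hom-cotwistor `φ : B ⊗ H → H ⊗ B` between Hom-coalgebras `B` and `H`
(conditions (M1)-(M4) together with compatibility with the structure maps). -/
def IsHomCotwistor (αB : B ≃ₗ[k] B) (ΔB : B →ₗ[k] B ⊗[k] B) (εB : B →ₗ[k] k)
    (αH : H ≃ₗ[k] H) (ΔH : H →ₗ[k] H ⊗[k] H) (εH : H →ₗ[k] k)
    (φ : B ⊗[k] H →ₗ[k] H ⊗[k] B) : Prop :=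
  (φ ∘ₗ TensorProduct.map αB.toLinearMap αH.toLinearMap
     = TensorProduct.map αH.toLinearMap αB.toLinearMap ∘ₗ φ) ∧
  -- (M1)
  (TensorProduct.map αH.toLinearMap ΔB ∘ₗ φ
     = (TensorProduct.assoc k H B B).toLinearMap
       ∘ₗ TensorProduct.map φ (LinearMap.id : B →ₗ[k] B)
       ∘ₗ (TensorProduct.assoc k B H B).symm.toLinearMap
       ∘ₗ TensorProduct.map (LinearMap.id : B →ₗ[k] B) φ
       ∘ₗ (TensorProduct.assoc k B B H).toLinearMap
       ∘ₗ TensorProduct.map ΔB αH.toLinearMap) ∧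
  -- (M2)
  (TensorProduct.map ΔH αB.toLinearMap ∘ₗ φ
     = (TensorProduct.assoc k H H B).symm.toLinearMap
       ∘ₗ TensorProduct.map (LinearMap.id : H →ₗ[k] H) φ
       ∘ₗ (TensorProduct.assoc k H B H).toLinearMap
       ∘ₗ TensorProduct.map φ (LinearMap.id : H →ₗ[k] H)
       ∘ₗ (TensorProduct.assoc k B H H).symm.toLinearMap
       ∘ₗ TensorProduct.map αB.toLinearMap ΔH) ∧
  -- (M3)
  ((TensorProduct.lid k B).toLinearMap
      ∘ₗ TensorProduct.map εH (LinearMap.id : B →ₗ[k] B) ∘ₗ φ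
     = (TensorProduct.rid k B).toLinearMap
        ∘ₗ TensorProduct.map (LinearMap.id : B →ₗ[k] B) εH) ∧
  -- (M4)
  ((TensorProduct.rid k H).toLinearMap
      ∘ₗ TensorProduct.map (LinearMap.id : H →ₗ[k] H) εB ∘ₗ φ
     = (TensorProduct.lid k H).toLinearMap
        ∘ₗ TensorProduct.map εB (LinearMap.id : H →ₗ[k] H))

/-- A monoidal Hom-cotwistor between Hom-bialgebras `B` and `H`:
a Hom-cotwistor additionally satisfying (M5) and (M6). -/
def IsMonoidalHomCotwistor (αB : B ≃ₗ[k] B) (μB : B →ₗ[k] B →ₗ[k] B) (eB : B)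
    (ΔB : B →ₗ[k] B ⊗[k] B) (εB : B →ₗ[k] k)
    (αH : H ≃ₗ[k] H) (μH : H →ₗ[k] H →ₗ[k] H) (eH : H)
    (ΔH : H →ₗ[k] H ⊗[k] H) (εH : H →ₗ[k] k)
    (φ : B ⊗[k] H →ₗ[k] H ⊗[k] B) : Prop :=
  IsHomCotwistor k αB ΔB εB αH ΔH εH φ ∧
  -- (M5)
  (TensorProduct.map (TensorProduct.lift μH) (TensorProduct.lift μB)
      ∘ₗ (TensorProduct.tensorTensorTensorComm k H B H B).toLinearMap
      ∘ₗ TensorProduct.map φ φ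
    = φ ∘ₗ TensorProduct.map (TensorProduct.lift μB) (TensorProduct.lift μH)
        ∘ₗ (TensorProduct.tensorTensorTensorComm k B H B H).toLinearMap) ∧
  -- (M6)
  φ (eB ⊗ₜ[k] eH) = eH ⊗ₜ[k] eB

/-- A Hom-entwining map `Φ : H ⊗ A → A ⊗ H` (conditions (E1)-(E4) together
with compatibility with the structure maps); `(H, A, Φ)` is then a
Hom-entwining structure. -/
def IsHomEntwining (αA : A ≃ₗ[k] A) (μ : A →ₗ[k] A →ₗ[k] A) (e : A)
    (αH : H ≃ₗ[k] H) (Δ : H →ₗ[k] H ⊗[k] H) (ε : H →ₗ[k] k)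
    (Φ : H ⊗[k] A →ₗ[k] A ⊗[k] H) : Prop :=
  (TensorProduct.map αA.toLinearMap αH.toLinearMap ∘ₗ Φ
     = Φ ∘ₗ TensorProduct.map αH.toLinearMap αA.toLinearMap) ∧
  -- (E1)
  (TensorProduct.map (TensorProduct.lift μ) αH.toLinearMap
      ∘ₗ (TensorProduct.assoc k A A H).symm.toLinearMap
      ∘ₗ TensorProduct.map (LinearMap.id : A →ₗ[k] A) Φ
      ∘ₗ (TensorProduct.assoc k A H A).toLinearMap
      ∘ₗ TensorProduct.map Φ (LinearMap.id : A →ₗ[k] A)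
    = Φ ∘ₗ TensorProduct.map αH.toLinearMap (TensorProduct.lift μ)
        ∘ₗ (TensorProduct.assoc k H A A).toLinearMap) ∧
  -- (E2)
  (TensorProduct.map αA.toLinearMap Δ ∘ₗ Φ
     = (TensorProduct.assoc k A H H).toLinearMap
       ∘ₗ TensorProduct.map Φ (LinearMap.id : H →ₗ[k] H)
       ∘ₗ (TensorProduct.assoc k H A H).symm.toLinearMap
       ∘ₗ TensorProduct.map (LinearMap.id : H →ₗ[k] H) Φ
       ∘ₗ (TensorProduct.assoc k H H A).toLinearMap
       ∘ₗ TensorProduct.map Δ αA.toLinearMap) ∧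
  -- (E3)
  ((TensorProduct.rid k A).toLinearMap
      ∘ₗ TensorProduct.map (LinearMap.id : A →ₗ[k] A) ε ∘ₗ Φ
     = (TensorProduct.lid k A).toLinearMap
        ∘ₗ TensorProduct.map ε (LinearMap.id : A →ₗ[k] A)) ∧
  -- (E4)
  (∀ h, Φ (h ⊗ₜ[k] e) = e ⊗ₜ[k] h)

/-- A Hom-monoidal entwining datum between Hom-bialgebras `H` (coalgebra side)
and `A` (algebra side): a Hom-entwining map additionally satisfying (E5), (E6). -/
def IsHomMonoidalEntwining (αA : A ≃ₗ[k] A) (μA : A →ₗ[k] A →ₗ[k] A) (eA : A)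
    (ΔA : A →ₗ[k] A ⊗[k] A) (εA : A →ₗ[k] k)
    (αH : H ≃ₗ[k] H) (μH : H →ₗ[k] H →ₗ[k] H) (eH : H)
    (ΔH : H →ₗ[k] H ⊗[k] H) (εH : H →ₗ[k] k)
    (Φ : H ⊗[k] A →ₗ[k] A ⊗[k] H) : Prop :=
  IsHomEntwining k αA μA eA αH ΔH εH Φ ∧
  -- (E5)
  (TensorProduct.map (LinearMap.id : A ⊗[k] A →ₗ[k] A ⊗[k] A) (TensorProduct.lift μH)
      ∘ₗ (TensorProduct.tensorTensorTensorComm k A H A H).toLinearMap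
      ∘ₗ TensorProduct.map Φ Φ
      ∘ₗ (TensorProduct.tensorTensorTensorComm k H H A A).toLinearMap
      ∘ₗ TensorProduct.map
           (TensorProduct.map (αH.toLinearMap ∘ₗ αH.toLinearMap)
             (αH.toLinearMap ∘ₗ αH.toLinearMap)) ΔA
    = TensorProduct.map ΔA (αH.toLinearMap ∘ₗ αH.toLinearMap)
        ∘ₗ Φ ∘ₗ TensorProduct.map (TensorProduct.lift μH) (LinearMap.id : A →ₗ[k] A)) ∧
  -- (E6)
  (∀ a, TensorProduct.lid k H
      (TensorProduct.map εA (LinearMap.id : H →ₗ[k] H) (Φ (eH ⊗ₜ[k] a))) = εA a • eH)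

/-- An `n`-th Hom-entwined module over a Hom-entwining structure `(H, A, Φ)`. -/
def IsHomEntwinedModule (αA : A ≃ₗ[k] A) (μ : A →ₗ[k] A →ₗ[k] A) (e : A)
    (αH : H ≃ₗ[k] H) (Δ : H →ₗ[k] H ⊗[k] H) (ε : H →ₗ[k] k)
    (Φ : H ⊗[k] A →ₗ[k] A ⊗[k] H) (n : ℤ)
    (αU : U ≃ₗ[k] U) (act : U →ₗ[k] A →ₗ[k] U) (ρ : U →ₗ[k] U ⊗[k] H) : Prop :=
  IsHomModule k αA μ e αU act ∧
  IsHomComodule k αH Δ ε αU ρ ∧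
  ∀ u a, ρ (act u a)
    = TensorProduct.map
        (TensorProduct.lift act ∘ₗ
          TensorProduct.map (LinearMap.id : U →ₗ[k] U) αA.toLinearMap)
        ((αH ^ (-n)).toLinearMap)
        ((TensorProduct.assoc k U A H).symm
          (TensorProduct.map (LinearMap.id : U →ₗ[k] U)
            (Φ ∘ₗ TensorProduct.map ((αH ^ (n + 1)).toLinearMap)
               (LinearMap.id : A →ₗ[k] A))
            (TensorProduct.assoc k U H A (ρ u ⊗ₜ[k] a))))

/-- A Hom-Long dimodule over a Hom-bialgebra `H`. -/
def IsHomLongDimodule (αH : H ≃ₗ[k] H) (μ : H →ₗ[k] H →ₗ[k] H) (e : H)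
    (Δ : H →ₗ[k] H ⊗[k] H) (ε : H →ₗ[k] k)
    (αU : U ≃ₗ[k] U) (act : U →ₗ[k] H →ₗ[k] U) (ρ : U →ₗ[k] U ⊗[k] H) : Prop :=
  IsHomModule k αH μ e αU act ∧
  IsHomComodule k αH Δ ε αU ρ ∧
  ∀ u h, ρ (act u h)
    = TensorProduct.map (TensorProduct.lift act) αH.toLinearMap
        ((TensorProduct.assoc k U H H).symm
          (TensorProduct.map (LinearMap.id : U →ₗ[k] U)
            (TensorProduct.comm k H H).toLinearMap
            (TensorProduct.assoc k U H H (ρ u ⊗ₜ[k] αH h))))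

/-- A right `H`-comodule algebra over a Hom-bialgebra `H`. -/
def IsHomComoduleAlgebra (αH : H ≃ₗ[k] H) (μH : H →ₗ[k] H →ₗ[k] H) (eH : H)
    (ΔH : H →ₗ[k] H ⊗[k] H) (εH : H →ₗ[k] k)
    (αA : A ≃ₗ[k] A) (μA : A →ₗ[k] A →ₗ[k] A) (eA : A)
    (ρA : A →ₗ[k] A ⊗[k] H) : Prop :=
  IsHomAlgebra k αA μA eA ∧
  IsHomComodule k αH ΔH εH αA ρA ∧
  (∀ a b, ρA (μA a b) = TensorProduct.map (TensorProduct.lift μA) (TensorProduct.lift μH)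
      (TensorProduct.tensorTensorTensorComm k A H A H (ρA a ⊗ₜ[k] ρA b))) ∧
  ρA eA = eA ⊗ₜ[k] eH

/-- A right `H`-module coalgebra over a Hom-bialgebra `H`. -/
def IsHomModuleCoalgebra (αH : H ≃ₗ[k] H) (μH : H →ₗ[k] H →ₗ[k] H) (eH : H)
    (ΔH : H →ₗ[k] H ⊗[k] H) (εH : H →ₗ[k] k)
    (αC : C ≃ₗ[k] C) (ΔC : C →ₗ[k] C ⊗[k] C) (εC : C →ₗ[k] k)
    (act : C →ₗ[k] H →ₗ[k] C) : Prop :=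
  IsHomCoalgebra k αC ΔC εC ∧
  IsHomModule k αH μH eH αC act ∧
  (∀ c h, ΔC (act c h) = TensorProduct.map (TensorProduct.lift act) (TensorProduct.lift act)
      (TensorProduct.tensorTensorTensorComm k C C H H (ΔC c ⊗ₜ[k] ΔH h))) ∧
  (∀ c h, εC (act c h) = εC c * εH h)

/-- A Hom-Hopf algebra `(H, α, μ, e, Δ, ε, S)` over `k`. -/
def IsHomHopf (αH : H ≃ₗ[k] H) (μ : H →ₗ[k] H →ₗ[k] H) (e : H)
    (Δ : H →ₗ[k] H ⊗[k] H) (ε : H →ₗ[k] k) (S : H →ₗ[k] H) : Prop :=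
  IsHomBialgebra k αH μ e Δ ε ∧
  (∀ h, S (αH h) = αH (S h)) ∧
  (∀ h, TensorProduct.lift μ
      (TensorProduct.map S (LinearMap.id : H →ₗ[k] H) (Δ h)) = ε h • e) ∧
  (∀ h, TensorProduct.lift μ
      (TensorProduct.map (LinearMap.id : H →ₗ[k] H) S (Δ h)) = ε h • e)

/-- A `p`-th right-right Yetter-Drinfeld module over a Hom-Hopf algebra `H`. -/
def IsYetterDrinfeld (αH : H ≃ₗ[k] H) (μ : H →ₗ[k] H →ₗ[k] H) (e : H)
    (Δ : H →ₗ[k] H ⊗[k] H) (ε : H →ₗ[k] k) (S : H →ₗ[k] H) (p : ℤ)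
    (αU : U ≃ₗ[k] U) (act : U →ₗ[k] H →ₗ[k] U) (ρ : U →ₗ[k] U ⊗[k] H) : Prop :=
  IsHomModule k αH μ e αU act ∧
  IsHomComodule k αH Δ ε αU ρ ∧
  ∀ u h, ρ (act u h)
    = TensorProduct.map
        (TensorProduct.lift act ∘ₗ
          TensorProduct.map (LinearMap.id : U →ₗ[k] U) αH.symm.toLinearMap)
        (TensorProduct.lift μ ∘ₗ
          TensorProduct.map (S ∘ₗ (αH ^ (p - 2)).toLinearMap)
            (TensorProduct.lift μ ∘ₗ
              TensorProduct.map αH.symm.toLinearMap ((αH ^ (p - 4)).toLinearMap)))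
        (TensorProduct.tensorTensorTensorComm k U H H (H ⊗[k] H)
          (TensorProduct.map (LinearMap.id : U ⊗[k] H →ₗ[k] U ⊗[k] H)
            (TensorProduct.leftComm k H H H).toLinearMap
            (TensorProduct.tensorTensorTensorComm k U H H (H ⊗[k] H)
              (ρ u ⊗ₜ[k]
                TensorProduct.map (LinearMap.id : H →ₗ[k] H) Δ (Δ h)))))

/-- The smash coproduct comultiplication on `B ⊗ H` induced by
`φ : B ⊗ H → H ⊗ B`: `Δ(b ⊗ h) = (b₁ ⊗ (h₁)^φ) ⊗ ((b₂)^φ ⊗ h₂)`. -/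
def smashComul (φ : B ⊗[k] H →ₗ[k] H ⊗[k] B) (ΔB : B →ₗ[k] B ⊗[k] B)
    (ΔH : H →ₗ[k] H ⊗[k] H) : B ⊗[k] H →ₗ[k] (B ⊗[k] H) ⊗[k] (B ⊗[k] H) :=
  (TensorProduct.assoc k B H (B ⊗[k] H)).symm.toLinearMap
  ∘ₗ TensorProduct.map (LinearMap.id : B →ₗ[k] B)
       (TensorProduct.assoc k H B H).toLinearMap
  ∘ₗ TensorProduct.map (LinearMap.id : B →ₗ[k] B)
       (TensorProduct.map φ (LinearMap.id : H →ₗ[k] H))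
  ∘ₗ TensorProduct.map (LinearMap.id : B →ₗ[k] B)
       (TensorProduct.assoc k B H H).symm.toLinearMap
  ∘ₗ (TensorProduct.assoc k B B (H ⊗[k] H)).toLinearMap
  ∘ₗ TensorProduct.map ΔB ΔH

/-- The smash coproduct counit on `B ⊗ H`: `ε(b ⊗ h) = εB(b) εH(h)`. -/
def smashCounit (εB : B →ₗ[k] k) (εH : H →ₗ[k] k) : B ⊗[k] H →ₗ[k] k :=
  (TensorProduct.lid k k).toLinearMap ∘ₗ TensorProduct.map εB εH

/-- The componentwise product on `B ⊗ H`: `(a ⊗ h)(b ⊗ g) = ab ⊗ hg`. -/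
def smashMul (μB : B →ₗ[k] B →ₗ[k] B) (μH : H →ₗ[k] H →ₗ[k] H) :
    B ⊗[k] H →ₗ[k] B ⊗[k] H →ₗ[k] B ⊗[k] H :=
  (TensorProduct.mk k (B ⊗[k] H) (B ⊗[k] H)).compr₂
    (TensorProduct.map (TensorProduct.lift μB) (TensorProduct.lift μH)
      ∘ₗ (TensorProduct.tensorTensorTensorComm k B H B H).toLinearMap)

/-- Threefold "componentwise comultiplication" `(C⊗C)⊗C → ((C⊗C)⊗C) ⊗ ((C⊗C)⊗C)`
obtained by applying `Δ2` to each factor and pairing the first and second legs. -/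
def convDelta3 (Δ2 : C →ₗ[k] C ⊗[k] C) :
    (C ⊗[k] C) ⊗[k] C →ₗ[k] ((C ⊗[k] C) ⊗[k] C) ⊗[k] ((C ⊗[k] C) ⊗[k] C) :=
  (TensorProduct.tensorTensorTensorComm k (C ⊗[k] C) (C ⊗[k] C) C C).toLinearMap
  ∘ₗ TensorProduct.map (TensorProduct.tensorTensorTensorComm k C C C C).toLinearMap
       (LinearMap.id : C ⊗[k] C →ₗ[k] C ⊗[k] C)
  ∘ₗ TensorProduct.map (TensorProduct.map Δ2 Δ2) Δ2

/-- The map `ξ_{X,Y}(x ⊗ y) = α_X⁻¹(x)·α_H^m(y₍₁₎) ⊗ α_Y⁻¹(y₍₀₎)` for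
Hom-Long dimodules `X`, `Y`. -/
def longXi (m : ℤ) (αH : H ≃ₗ[k] H) (αX : X ≃ₗ[k] X) (αY : Y ≃ₗ[k] Y)
    (act : X →ₗ[k] H →ₗ[k] X) (ρ : Y →ₗ[k] Y ⊗[k] H) : X ⊗[k] Y →ₗ[k] X ⊗[k] Y :=
  TensorProduct.map
      (TensorProduct.lift act ∘ₗ
        TensorProduct.map (LinearMap.id : X →ₗ[k] X) ((αH ^ m).toLinearMap))
      αY.symm.toLinearMap
    ∘ₗ (TensorProduct.assoc k X H Y).symm.toLinearMap
    ∘ₗ TensorProduct.map (LinearMap.id : X →ₗ[k] X) (TensorProduct.comm k Y H).toLinearMap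
    ∘ₗ TensorProduct.map αX.symm.toLinearMap ρ

/-- The associativity constraint `a_{X,Y,Z}((x⊗y)⊗z) = α_X^{i+1}(x) ⊗ (y ⊗ α_Z^{-j-1}(z))`. -/
def homAssoc (i j : ℤ) (αX : X ≃ₗ[k] X) (αZ : Z ≃ₗ[k] Z) :
    (X ⊗[k] Y) ⊗[k] Z ≃ₗ[k] X ⊗[k] (Y ⊗[k] Z) :=
  (TensorProduct.assoc k X Y Z).trans
    (TensorProduct.congr (αX ^ (i + 1))
      (TensorProduct.congr (LinearEquiv.refl k Y) (αZ ^ (-j - 1))))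

/-- The braiding `τ_{X,Y}(x ⊗ y) = α_Y^{j-i-1}(y₍₀₎) ⊗ α_X^{i-j-1}(x)·α_H^{-p}(y₍₁₎)`
for Yetter-Drinfeld modules. -/
def ydTau (p i j : ℤ) (αH : H ≃ₗ[k] H) (αX : X ≃ₗ[k] X) (αY : Y ≃ₗ[k] Y)
    (act : X →ₗ[k] H →ₗ[k] X) (ρ : Y →ₗ[k] Y ⊗[k] H) : X ⊗[k] Y →ₗ[k] Y ⊗[k] X :=
  TensorProduct.map ((αY ^ (j - i - 1)).toLinearMap)
      (TensorProduct.lift act ∘ₗ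
        TensorProduct.map ((αX ^ (i - j - 1)).toLinearMap) ((αH ^ (-p)).toLinearMap))
    ∘ₗ (TensorProduct.leftComm k X Y H).toLinearMap
    ∘ₗ TensorProduct.map (LinearMap.id : X →ₗ[k] X) ρ

end HomDefs

section Transpose

variable {k}
variable {A H M N : Type*} [AddCommGroup A] [Module k A] [AddCommGroup H] [Module k H]
variable [AddCommGroup M] [Module k M] [AddCommGroup N] [Module k N]

/-- Evaluation of the left tensor factor under a linear form: `a ⊗ h ↦ f a • h`. -/
def evalLeft (f : Module.Dual k A) : A ⊗[k] H →ₗ[k] H :=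
  (TensorProduct.lid k H).toLinearMap ∘ₗ TensorProduct.map f LinearMap.id

/-- Evaluation of the right tensor factor at a vector: `h ⊗ f ↦ f a • h`. -/
def evalRight (a : A) : H ⊗[k] Module.Dual k A →ₗ[k] H :=
  (TensorProduct.rid k H).toLinearMap ∘ₗ TensorProduct.map LinearMap.id (Module.Dual.eval k A a)

@[simp]
theorem evalLeft_tmul (f : Module.Dual k A) (a : A) (h : H) :
    evalLeft f (a ⊗ₜ[k] h) = f a • h := by
  simp [evalLeft]

@[simp]
theorem evalRight_tmul (a : A) (h : H) (f : Module.Dual k A) :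
    evalRight a (h ⊗ₜ[k] f) = f a • h := by
  simp [evalRight]

theorem evalLeft_map (f : Module.Dual k M) (u : A →ₗ[k] M) (v : H →ₗ[k] N) (t : A ⊗[k] H) :
    evalLeft f (TensorProduct.map u v t) = v (evalLeft (f ∘ₗ u) t) := by
  induction t with
  | zero => simp
  | add x y hx hy => simp only [map_add, hx, hy]
  | tmul a h => simp

/-- Linear forms on a free module separate the points of a tensor product. -/
theorem ext_evalLeft [Module.Free k A] {s t : A ⊗[k] H}
    (h : ∀ f : Module.Dual k A, evalLeft f s = evalLeft f t) : s = t := by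
  let b := Module.Free.chooseBasis k A
  apply (TensorProduct.equivFinsuppOfBasisLeft (N := H) b).injective
  ext i
  have key : ∀ u : A ⊗[k] H,
      TensorProduct.equivFinsuppOfBasisLeft b u i = evalLeft (b.coord i) u := by
    intro u
    induction u with
    | zero => simp
    | add x y hx hy => simp only [map_add, Finsupp.add_apply, hx, hy]
    | tmul a h => simp
  rw [key, key, h]

theorem dualTensorHom_comm (t : H ⊗[k] Module.Dual k A) (a : A) :
    dualTensorHom k A H (TensorProduct.comm k H (Module.Dual k A) t) a = evalRight a t := by
  induction t with
  | zero => simp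
  | add x y hx hy => simp only [map_add, LinearMap.add_apply, hx, hy]
  | tmul h f => simp

/-- Evaluations separate the points of a tensor product with a finite-dimensional dual. -/
theorem ext_evalRight [FiniteDimensional k A] {s t : H ⊗[k] Module.Dual k A}
    (h : ∀ a : A, evalRight a s = evalRight a t) : s = t := by
  apply (TensorProduct.comm k H (Module.Dual k A)).injective
  apply (dualTensorHomEquivOfBasis (N := H) (Module.finBasis k A)).injective
  ext a
  simp only [dualTensorHomEquivOfBasis_apply, dualTensorHom_comm, h]

theorem evalRight_map_dualMap (α : A ≃ₗ[k] A) (a : A) (v : H →ₗ[k] N)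
    (t : H ⊗[k] Module.Dual k A) :
    evalRight a (TensorProduct.map v α.symm.dualMap.toLinearMap t)
      = v (evalRight (α.symm a) t) := by
  induction t with
  | zero => simp
  | add x y hx hy => simp only [map_add, hx, hy]
  | tmul h f => simp

/-- Two-variable evaluation on `H ⊗ (A* ⊗ A*)`. -/
theorem evalRight_evalRight_assoc_symm (x y : A)
    (t : H ⊗[k] (Module.Dual k A ⊗[k] Module.Dual k A)) :
    evalRight x (evalRight y ((TensorProduct.assoc k H _ _).symm t))
      = TensorProduct.rid k H (TensorProduct.map LinearMap.id
          (Module.Dual.eval k (A ⊗[k] A) (x ⊗ₜ y) ∘ₗ TensorProduct.dualDistrib k A A) t) := by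
  induction t with
  | zero => simp
  | add x y hx hy => simp only [map_add, hx, hy]
  | tmul h f =>
    induction f with
    | zero => simp
    | add x y hx hy => simp only [TensorProduct.tmul_add, map_add, hx, hy]
    | tmul f g => simp [smul_smul, mul_comm]

theorem ext_evalRight_evalRight [FiniteDimensional k A]
    {s t : H ⊗[k] (Module.Dual k A ⊗[k] Module.Dual k A)}
    (h : ∀ x y : A, evalRight x (evalRight y ((TensorProduct.assoc k H _ _).symm s))
      = evalRight x (evalRight y ((TensorProduct.assoc k H _ _).symm t))) : s = t := by
  apply (TensorProduct.assoc k H _ _).symm.injective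
  exact ext_evalRight fun y => ext_evalRight fun x => h x y

theorem ext_evalLeft_dualDistrib [Module.Free k A] {s t : (A ⊗[k] A) ⊗[k] H}
    (h : ∀ f g : Module.Dual k A,
      evalLeft (TensorProduct.dualDistrib k A A (f ⊗ₜ g)) s
        = evalLeft (TensorProduct.dualDistrib k A A (f ⊗ₜ g)) t) : s = t := by
  apply (TensorProduct.assoc k A A H).injective
  have key : ∀ (u : (A ⊗[k] A) ⊗[k] H) (f g : Module.Dual k A),
      evalLeft g (evalLeft f (TensorProduct.assoc k A A H u))
        = evalLeft (TensorProduct.dualDistrib k A A (f ⊗ₜ g)) u := by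
    intro u f g
    induction u with
    | zero => simp
    | add x y hx hy => simp only [map_add, hx, hy]
    | tmul a h =>
      induction a with
      | zero => simp
      | add x y hx hy => simp only [TensorProduct.add_tmul, map_add, hx, hy]
      | tmul a c => simp [smul_smul]
  refine ext_evalLeft fun f => ext_evalLeft fun g => ?_
  rw [key, key, h]

/-- Evaluating the tensor that represents a linear map recovers that map. -/
theorem evalRight_sum_dualBasis {ι : Type*} [Fintype ι] [DecidableEq ι] (b : Module.Basis ι k A)
    (L : A →ₗ[k] H) (a : A) :
    evalRight a (∑ i, L (b i) ⊗ₜ[k] b.dualBasis i) = L a := by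
  simp only [map_sum, evalRight_tmul, Module.Basis.coe_dualBasis, Module.Basis.coord_apply,
    ← map_smul]
  rw [← map_sum, b.sum_repr]

/-- `φ : A* ⊗ H → H ⊗ A*` is the transpose of `Φ : H ⊗ A → A ⊗ H` in the `A`-variable. -/
def IsTransposeOf (φ : Module.Dual k A ⊗[k] H →ₗ[k] H ⊗[k] Module.Dual k A)
    (Φ : H ⊗[k] A →ₗ[k] A ⊗[k] H) : Prop :=
  ∀ f h a, evalRight a (φ (f ⊗ₜ[k] h)) = evalLeft f (Φ (h ⊗ₜ[k] a))

variable {φ : Module.Dual k A ⊗[k] H →ₗ[k] H ⊗[k] Module.Dual k A}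
variable {Φ : H ⊗[k] A →ₗ[k] A ⊗[k] H}

theorem evalLeft_comp_symm {αA : A ≃ₗ[k] A} {αH : H ≃ₗ[k] H}
    (hc : TensorProduct.map αA.toLinearMap αH.toLinearMap ∘ₗ Φ
      = Φ ∘ₗ TensorProduct.map αH.toLinearMap αA.toLinearMap)
    (f : Module.Dual k A) (h : H) (a : A) :
    evalLeft (f ∘ₗ αA.symm.toLinearMap) (Φ (αH h ⊗ₜ[k] a))
      = αH (evalLeft f (Φ (h ⊗ₜ[k] αA.symm a))) := by
  have key := LinearMap.congr_fun hc (h ⊗ₜ[k] αA.symm a)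
  simp only [LinearMap.comp_apply, TensorProduct.map_tmul, LinearEquiv.coe_coe,
    LinearEquiv.apply_symm_apply] at key
  rw [← key, evalLeft_map, LinearMap.comp_assoc]
  simp

theorem IsTransposeOf.evalRight_evalRight_twist (hT : IsTransposeOf φ Φ)
    (t : Module.Dual k A ⊗[k] Module.Dual k A) (g : H) (x y : A) :
    evalRight x (evalRight y (TensorProduct.map φ LinearMap.id
        ((TensorProduct.assoc k _ H _).symm (TensorProduct.map LinearMap.id φ
          (TensorProduct.assoc k _ _ H (t ⊗ₜ[k] g))))))
      = evalLeft (TensorProduct.dualDistrib k A A (TensorProduct.comm k _ _ t))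
        ((TensorProduct.assoc k A A H).symm (TensorProduct.map LinearMap.id Φ
          (TensorProduct.assoc k A H A (Φ (g ⊗ₜ[k] y) ⊗ₜ[k] x)))) := by
  induction t with
  | zero => simp [evalLeft]
  | add s t hs ht =>
    have hadd : ∀ (p q : Module.Dual k (A ⊗[k] A)) (z : (A ⊗[k] A) ⊗[k] H),
        evalLeft (p + q) z = evalLeft p z + evalLeft q z := by
      intro p q z
      simp [evalLeft, TensorProduct.map_add_left]
    simp only [TensorProduct.add_tmul, map_add, hs, ht, hadd]
  | tmul f₁ f₂ =>
    have hleft : ∀ R : H ⊗[k] Module.Dual k A,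
        evalRight x (evalRight y (TensorProduct.map φ LinearMap.id
          ((TensorProduct.assoc k _ H _).symm (f₁ ⊗ₜ[k] R))))
          = evalLeft f₁ (Φ (evalRight y R ⊗ₜ[k] x)) := by
      intro R
      induction R with
      | zero => simp
      | add p q hp hq => simp only [TensorProduct.tmul_add, TensorProduct.add_tmul, map_add, hp, hq]
      | tmul h u => simp [hT f₁ h x, ← TensorProduct.smul_tmul']
    have hmid : ∀ (c : A) (z : A ⊗[k] H),
        evalLeft (TensorProduct.dualDistrib k A A (f₂ ⊗ₜ[k] f₁))
          ((TensorProduct.assoc k A A H).symm (c ⊗ₜ[k] z)) = f₂ c • evalLeft f₁ z := by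
      intro c z
      induction z with
      | zero => simp
      | add p q hp hq => simp only [TensorProduct.tmul_add, map_add, hp, hq, smul_add]
      | tmul h u => simp [smul_smul]
    have hright : ∀ S : A ⊗[k] H,
        evalLeft (TensorProduct.dualDistrib k A A (f₂ ⊗ₜ[k] f₁))
          ((TensorProduct.assoc k A A H).symm (TensorProduct.map LinearMap.id Φ
            (TensorProduct.assoc k A H A (S ⊗ₜ[k] x))))
          = evalLeft f₁ (Φ (evalLeft f₂ S ⊗ₜ[k] x)) := by
      intro S
      induction S with
      | zero => simp
      | add p q hp hq => simp only [TensorProduct.add_tmul, map_add, hp, hq]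
      | tmul c h => simp [hmid, ← TensorProduct.smul_tmul']
    simp only [TensorProduct.assoc_tmul, TensorProduct.map_tmul, LinearMap.id_apply,
      TensorProduct.comm_tmul, hleft, hright, hT f₂ g y]

theorem IsTransposeOf.evalRight_twist (hT : IsTransposeOf φ Φ)
    (f : Module.Dual k A) (w : H ⊗[k] H) (a : A) :
    evalRight a ((TensorProduct.assoc k H H _).symm (TensorProduct.map LinearMap.id φ
        (TensorProduct.assoc k H _ H (TensorProduct.map φ LinearMap.id
          ((TensorProduct.assoc k _ H H).symm (f ⊗ₜ[k] w))))))
      = evalLeft f (TensorProduct.assoc k A H H (TensorProduct.map Φ LinearMap.id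
          ((TensorProduct.assoc k H A H).symm (TensorProduct.map LinearMap.id Φ
            (TensorProduct.assoc k H H A (w ⊗ₜ[k] a)))))) := by
  induction w with
  | zero => simp
  | add p q hp hq => simp only [TensorProduct.add_tmul, TensorProduct.tmul_add, map_add, hp, hq]
  | tmul h₁ h₂ =>
    have hpure : ∀ (h : H) (z : H ⊗[k] Module.Dual k A),
        evalRight a ((TensorProduct.assoc k H H _).symm (h ⊗ₜ[k] z))
          = h ⊗ₜ[k] evalRight a z := by
      intro h z
      induction z with
      | zero => simp
      | add p q hp hq => simp only [TensorProduct.tmul_add, map_add, hp, hq]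
      | tmul h u => simp
    have hleft : ∀ P : H ⊗[k] Module.Dual k A,
        evalRight a ((TensorProduct.assoc k H H _).symm (TensorProduct.map LinearMap.id φ
          (TensorProduct.assoc k H _ H (P ⊗ₜ[k] h₂))))
          = TensorProduct.map (dualTensorHom k A H (TensorProduct.comm k _ _ P)) LinearMap.id
            (Φ (h₂ ⊗ₜ[k] a)) := by
      intro P
      induction P with
      | zero => simp
      | add p q hp hq =>
        simp only [TensorProduct.add_tmul, map_add, hp, hq, TensorProduct.map_add_left,
          LinearMap.add_apply]
      | tmul h u =>
        simp only [TensorProduct.assoc_tmul, TensorProduct.map_tmul, LinearMap.id_apply, hpure,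
          hT u h₂ a, TensorProduct.comm_tmul]
        induction Φ (h₂ ⊗ₜ[k] a) with
        | zero => simp
        | add p q hp hq => simp only [TensorProduct.tmul_add, map_add, hp, hq]
        | tmul c g => simp [TensorProduct.smul_tmul]
    have hhom : dualTensorHom k A H (TensorProduct.comm k _ _ (φ (f ⊗ₜ[k] h₁)))
        = evalLeft f ∘ₗ Φ ∘ₗ TensorProduct.mk k H A h₁ := by
      ext c
      simp [dualTensorHom_comm, hT f h₁ c]
    have hassoc : ∀ (z : A ⊗[k] H) (g : H),
        evalLeft f (TensorProduct.assoc k A H H (z ⊗ₜ[k] g)) = evalLeft f z ⊗ₜ[k] g := by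
      intro z g
      induction z with
      | zero => simp
      | add p q hp hq => simp only [TensorProduct.add_tmul, map_add, hp, hq]
      | tmul c h => simp [TensorProduct.smul_tmul']
    simp only [TensorProduct.assoc_tmul, TensorProduct.assoc_symm_tmul, TensorProduct.map_tmul,
      LinearMap.id_apply, hleft, hhom]
    induction Φ (h₂ ⊗ₜ[k] a) with
    | zero => simp
    | add p q hp hq => simp only [TensorProduct.tmul_add, map_add, hp, hq]
    | tmul c g => simp [hassoc]

/-- The transpose of a Hom-entwining map is a Hom-cotwistor. -/
theorem IsTransposeOf.isHomCotwistor [FiniteDimensional k A] (hT : IsTransposeOf φ Φ)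
    {αA : A ≃ₗ[k] A} {μA : A →ₗ[k] A →ₗ[k] A} {eA : A}
    {αH : H ≃ₗ[k] H} {ΔH : H →ₗ[k] H ⊗[k] H} {εH : H →ₗ[k] k}
    (hΦ : IsHomEntwining k αA μA eA αH ΔH εH Φ)
    {Δbar : Module.Dual k A →ₗ[k] Module.Dual k A ⊗[k] Module.Dual k A}
    (hΔbar : ∀ (f : Module.Dual k A) (x y : A),
        TensorProduct.dualDistrib k A A (Δbar f) (x ⊗ₜ[k] y)
          = f (αA.symm (αA.symm (μA y x)))) :
    IsHomCotwistor k αA.symm.dualMap Δbar (Module.Dual.eval k A eA) αH ΔH εH φ := by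
  obtain ⟨hc, hE1, hE2, hE3, hE4⟩ := hΦ
  refine ⟨?_, ?_, ?_, ?_, ?_⟩
  · refine TensorProduct.ext' fun f h => ext_evalRight fun a => ?_
    simp only [LinearMap.comp_apply, TensorProduct.map_tmul, evalRight_map_dualMap, hT _ _ _,
      LinearEquiv.coe_coe]
    exact evalLeft_comp_symm hc f h a
  · refine TensorProduct.ext' fun f h => ext_evalRight_evalRight fun x y => ?_
    have hmap : ∀ R : H ⊗[k] Module.Dual k A,
        evalRight x (evalRight y ((TensorProduct.assoc k H _ _).symm
          (TensorProduct.map αH.toLinearMap Δbar R)))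
          = αH (evalRight (αA.symm (αA.symm (μA y x))) R) := by
      intro R
      rw [evalRight_evalRight_assoc_symm]
      induction R with
      | zero => simp
      | add p q hp hq => simp only [map_add, hp, hq]
      | tmul h u => simp [hΔbar]
    have hdd : TensorProduct.dualDistrib k A A (TensorProduct.comm k _ _ (Δbar f))
        = ((f ∘ₗ αA.symm.toLinearMap) ∘ₗ αA.symm.toLinearMap) ∘ₗ TensorProduct.lift μA := by
      refine TensorProduct.ext' fun a c => ?_
      have hcomm : ∀ t : Module.Dual k A ⊗[k] Module.Dual k A,
          TensorProduct.dualDistrib k A A (TensorProduct.comm k _ _ t) (a ⊗ₜ[k] c)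
            = TensorProduct.dualDistrib k A A t (c ⊗ₜ[k] a) := by
        intro t
        induction t with
        | zero => simp
        | add p q hp hq => simp only [map_add, LinearMap.add_apply, hp, hq]
        | tmul u v => simp [mul_comm]
      simp [hcomm, hΔbar]
    have key := LinearMap.congr_fun hE1 ((αH h ⊗ₜ[k] y) ⊗ₜ[k] x)
    simp only [LinearMap.comp_apply, TensorProduct.map_tmul, LinearEquiv.coe_coe,
      LinearMap.id_apply, TensorProduct.assoc_tmul, TensorProduct.lift.tmul] at key
    have key' := congrArg (evalLeft ((f ∘ₗ αA.symm.toLinearMap) ∘ₗ αA.symm.toLinearMap)) key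
    rw [evalLeft_map, evalLeft_comp_symm hc, evalLeft_comp_symm hc] at key'
    simp only [LinearMap.comp_apply, TensorProduct.map_tmul, LinearEquiv.coe_coe, hmap,
      LinearEquiv.symm_apply_apply, hT.evalRight_evalRight_twist, hT f h _, hdd]
    exact (αH.injective key').symm
  · refine TensorProduct.ext' fun f h => ext_evalRight fun a => ?_
    have key := congrArg (evalLeft (f ∘ₗ αA.symm.toLinearMap))
      (LinearMap.congr_fun hE2 (h ⊗ₜ[k] αA.symm a))
    simp only [LinearMap.comp_apply, TensorProduct.map_tmul, LinearEquiv.coe_coe,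
      LinearEquiv.apply_symm_apply, evalLeft_map] at key
    simp only [LinearMap.comp_apply, TensorProduct.map_tmul, LinearEquiv.coe_coe,
      evalRight_map_dualMap, hT f h _, hT.evalRight_twist]
    refine Eq.trans ?_ key
    rw [LinearMap.comp_assoc]
    simp
  · refine TensorProduct.ext' fun f h => LinearMap.ext fun a => ?_
    have hmap : ∀ R : H ⊗[k] Module.Dual k A,
        TensorProduct.lid k (Module.Dual k A) (TensorProduct.map εH LinearMap.id R) a
          = εH (evalRight a R) := by
      intro R
      induction R with
      | zero => simp
      | add p q hp hq => simp only [map_add, LinearMap.add_apply, hp, hq]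
      | tmul h u => simp [mul_comm]
    have hrid : ∀ z : A ⊗[k] H,
        f (TensorProduct.rid k A (TensorProduct.map LinearMap.id εH z)) = εH (evalLeft f z) := by
      intro z
      induction z with
      | zero => simp
      | add p q hp hq => simp only [map_add, hp, hq]
      | tmul c h => simp [mul_comm]
    have key := congrArg f (LinearMap.congr_fun hE3 (h ⊗ₜ[k] a))
    simp only [LinearMap.comp_apply, LinearEquiv.coe_coe, hrid] at key
    simp only [LinearMap.comp_apply, LinearEquiv.coe_coe, hmap, hT f h a, key]
    simp
  · refine TensorProduct.ext' fun f h => ?_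
    have key := hT f h eA
    rw [hE4] at key
    simpa [evalRight] using key

/-- A map is compatible with products and coproducts as in (E5) iff its transpose is
multiplicative as in (M5). -/
theorem IsTransposeOf.map_mul_iff [FiniteDimensional k A] (hT : IsTransposeOf φ Φ)
    {αA : A ≃ₗ[k] A} {ΔA : A →ₗ[k] A ⊗[k] A} {αH : H ≃ₗ[k] H} {μH : H →ₗ[k] H →ₗ[k] H}
    (hc : TensorProduct.map αA.toLinearMap αH.toLinearMap ∘ₗ Φ
      = Φ ∘ₗ TensorProduct.map αH.toLinearMap αA.toLinearMap)
    (hμ : ∀ a b, αH (μH a b) = μH (αH a) (αH b))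
    {star : Module.Dual k A →ₗ[k] Module.Dual k A →ₗ[k] Module.Dual k A}
    (hstar : ∀ (f f' : Module.Dual k A) (y : A),
        star f f' y = TensorProduct.dualDistrib k A A
          ((f ∘ₗ (αA.symm.toLinearMap ∘ₗ αA.symm.toLinearMap)) ⊗ₜ[k]
            (f' ∘ₗ (αA.symm.toLinearMap ∘ₗ αA.symm.toLinearMap))) (ΔA y)) :
    (TensorProduct.map (LinearMap.id : A ⊗[k] A →ₗ[k] A ⊗[k] A) (TensorProduct.lift μH)
        ∘ₗ (TensorProduct.tensorTensorTensorComm k A H A H).toLinearMap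
        ∘ₗ TensorProduct.map Φ Φ
        ∘ₗ (TensorProduct.tensorTensorTensorComm k H H A A).toLinearMap
        ∘ₗ TensorProduct.map
             (TensorProduct.map (αH.toLinearMap ∘ₗ αH.toLinearMap)
               (αH.toLinearMap ∘ₗ αH.toLinearMap)) ΔA
      = TensorProduct.map ΔA (αH.toLinearMap ∘ₗ αH.toLinearMap)
          ∘ₗ Φ ∘ₗ TensorProduct.map (TensorProduct.lift μH) (LinearMap.id : A →ₗ[k] A)) ↔
    (TensorProduct.map (TensorProduct.lift μH) (TensorProduct.lift star)
        ∘ₗ (TensorProduct.tensorTensorTensorComm k H (Module.Dual k A) H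
          (Module.Dual k A)).toLinearMap
        ∘ₗ TensorProduct.map φ φ
      = φ ∘ₗ TensorProduct.map (TensorProduct.lift star) (TensorProduct.lift μH)
          ∘ₗ (TensorProduct.tensorTensorTensorComm k (Module.Dual k A) H (Module.Dual k A)
            H).toLinearMap) := by
  have hσ : ∀ f : Module.Dual k A, f ∘ₗ (αA.symm.toLinearMap ∘ₗ αA.symm.toLinearMap)
      = (f ∘ₗ αA.symm.toLinearMap) ∘ₗ αA.symm.toLinearMap := fun _ => rfl
  -- the two products, evaluated, agree up to `αH²`
  have hprod : ∀ (f f' : Module.Dual k A) (h g : H) (y : A),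
      evalLeft (TensorProduct.dualDistrib k A A
          ((f ∘ₗ (αA.symm.toLinearMap ∘ₗ αA.symm.toLinearMap)) ⊗ₜ[k]
            (f' ∘ₗ (αA.symm.toLinearMap ∘ₗ αA.symm.toLinearMap))))
        (TensorProduct.map (LinearMap.id : A ⊗[k] A →ₗ[k] A ⊗[k] A) (TensorProduct.lift μH)
          (TensorProduct.tensorTensorTensorComm k A H A H (TensorProduct.map Φ Φ
            (TensorProduct.tensorTensorTensorComm k H H A A
              ((αH (αH h) ⊗ₜ[k] αH (αH g)) ⊗ₜ[k] ΔA y)))))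
      = αH (αH (evalRight y (TensorProduct.map (TensorProduct.lift μH) (TensorProduct.lift star)
          (TensorProduct.tensorTensorTensorComm k H (Module.Dual k A) H (Module.Dual k A)
            (φ (f ⊗ₜ[k] h) ⊗ₜ[k] φ (f' ⊗ₜ[k] g)))))) := by
    intro f f' h g y
    have hA : ∀ (u v : Module.Dual k A) (s t : A ⊗[k] H),
        evalLeft (TensorProduct.dualDistrib k A A (u ⊗ₜ[k] v))
          (TensorProduct.map (LinearMap.id : A ⊗[k] A →ₗ[k] A ⊗[k] A) (TensorProduct.lift μH)
            (TensorProduct.tensorTensorTensorComm k A H A H (s ⊗ₜ[k] t)))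
          = μH (evalLeft u s) (evalLeft v t) := by
      intro u v s t
      induction s with
      | zero => simp
      | add p q hp hq => simp only [TensorProduct.add_tmul, map_add, LinearMap.add_apply, hp, hq]
      | tmul a h =>
        induction t with
        | zero => simp
        | add p q hp hq => simp only [TensorProduct.tmul_add, map_add, hp, hq]
        | tmul c g => simp [smul_smul, mul_comm]
    have hB : ∀ s t : H ⊗[k] Module.Dual k A,
        evalRight y (TensorProduct.map (TensorProduct.lift μH) (TensorProduct.lift star)
          (TensorProduct.tensorTensorTensorComm k H (Module.Dual k A) H (Module.Dual k A)
            (s ⊗ₜ[k] t)))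
          = TensorProduct.lift (LinearMap.compl₁₂ μH
              (dualTensorHom k A H (TensorProduct.comm k _ _ s) ∘ₗ
                (αA.symm.toLinearMap ∘ₗ αA.symm.toLinearMap))
              (dualTensorHom k A H (TensorProduct.comm k _ _ t) ∘ₗ
                (αA.symm.toLinearMap ∘ₗ αA.symm.toLinearMap))) (ΔA y) := by
      intro s t
      induction s with
      | zero =>
        simp only [TensorProduct.zero_tmul, map_zero]
        induction ΔA y with
        | zero => simp
        | add z w hz hw => simp only [map_add, ← hz, ← hw, add_zero]
        | tmul a c => simp
      | add p q hp hq =>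
        simp only [TensorProduct.add_tmul, map_add, hp, hq]
        induction ΔA y with
        | zero => simp
        | add z w hz hw => simp only [map_add, ← hz, ← hw]; abel
        | tmul a c => simp
      | tmul h u =>
        induction t with
        | zero =>
          simp only [TensorProduct.tmul_zero, map_zero]
          induction ΔA y with
          | zero => simp
          | add z w hz hw => simp only [map_add, ← hz, ← hw, add_zero]
          | tmul a c => simp
        | add p q hp hq =>
          simp only [TensorProduct.tmul_add, map_add, hp, hq]
          induction ΔA y with
          | zero => simp
          | add z w hz hw => simp only [map_add, ← hz, ← hw]; abel
          | tmul a c => simp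
        | tmul g v =>
          simp only [TensorProduct.tensorTensorTensorComm_tmul, TensorProduct.map_tmul,
            TensorProduct.lift.tmul, evalRight_tmul, hstar]
          induction ΔA y with
          | zero => simp
          | add z w hz hw => simp only [map_add, add_smul, hz, hw]
          | tmul a c => simp [smul_smul, mul_comm]
    rw [hB]
    induction ΔA y with
    | zero => simp
    | add z w hz hw => simp only [TensorProduct.tmul_add, map_add, hz, hw]
    | tmul a c =>
      simp only [TensorProduct.tensorTensorTensorComm_tmul, TensorProduct.map_tmul, hA, hσ,
        evalLeft_comp_symm hc, TensorProduct.lift.tmul, LinearMap.compl₁₂_apply,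
        LinearMap.comp_apply, LinearEquiv.coe_coe, dualTensorHom_comm, hT _ _ _, hμ]
  have hstar' : ∀ f f' : Module.Dual k A, star f f' = TensorProduct.dualDistrib k A A
          ((f ∘ₗ (αA.symm.toLinearMap ∘ₗ αA.symm.toLinearMap)) ⊗ₜ[k]
            (f' ∘ₗ (αA.symm.toLinearMap ∘ₗ αA.symm.toLinearMap))) ∘ₗ ΔA :=
    fun f f' => LinearMap.ext (hstar f f')
  constructor
  · intro hE
    refine TensorProduct.ext_fourfold' fun f h f' g => ext_evalRight fun y => ?_
    apply αH.injective
    apply αH.injective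
    have hy := congrArg (evalLeft (TensorProduct.dualDistrib k A A
          ((f ∘ₗ (αA.symm.toLinearMap ∘ₗ αA.symm.toLinearMap)) ⊗ₜ[k]
            (f' ∘ₗ (αA.symm.toLinearMap ∘ₗ αA.symm.toLinearMap)))))
      (LinearMap.congr_fun hE ((h ⊗ₜ[k] g) ⊗ₜ[k] y))
    simp only [LinearMap.comp_apply, TensorProduct.map_tmul, LinearEquiv.coe_coe, hprod,
      evalLeft_map, TensorProduct.lift.tmul, LinearMap.id_apply] at hy
    simp only [LinearMap.comp_apply, TensorProduct.map_tmul, LinearEquiv.coe_coe, hy,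
      TensorProduct.tensorTensorTensorComm_tmul, TensorProduct.lift.tmul, hT _ _ _, hstar']
  · intro hM
    refine TensorProduct.ext_threefold fun h g y => ext_evalLeft_dualDistrib fun f f' => ?_
    have hf : ∀ f : Module.Dual k A, f = (f ∘ₗ αA.toLinearMap ∘ₗ αA.toLinearMap) ∘ₗ
        (αA.symm.toLinearMap ∘ₗ αA.symm.toLinearMap) := by
      intro f
      ext a
      simp
    rw [hf f, hf f']
    generalize f ∘ₗ αA.toLinearMap ∘ₗ αA.toLinearMap = u
    generalize f' ∘ₗ αA.toLinearMap ∘ₗ αA.toLinearMap = v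
    have hy := congrArg (evalRight y) (LinearMap.congr_fun hM ((u ⊗ₜ[k] h) ⊗ₜ[k] (v ⊗ₜ[k] g)))
    simp only [LinearMap.comp_apply, TensorProduct.map_tmul, LinearEquiv.coe_coe,
      TensorProduct.tensorTensorTensorComm_tmul, TensorProduct.lift.tmul, hT _ _ _, hstar'] at hy
    simp only [LinearMap.comp_apply, TensorProduct.map_tmul, LinearEquiv.coe_coe, hprod,
      evalLeft_map, TensorProduct.lift.tmul, LinearMap.id_apply, hy]

/-- Counitality as in (E6) is unitality of the transpose as in (M6). -/
theorem IsTransposeOf.map_unit_iff [FiniteDimensional k A] (hT : IsTransposeOf φ Φ)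
    (εA : Module.Dual k A) (eH : H) :
    (∀ a, evalLeft εA (Φ (eH ⊗ₜ[k] a)) = εA a • eH) ↔ φ (εA ⊗ₜ[k] eH) = eH ⊗ₜ[k] εA := by
  constructor
  · intro h
    exact ext_evalRight fun a => by rw [hT, h, evalRight_tmul]
  · intro h a
    rw [← hT, h, evalRight_tmul]

end Transpose

/-- a Hom-entwining map `Φ` between Hom-bialgebras is a
Hom-monoidal entwining datum iff the associated cotwistor `φ` is a monoidal
Hom-cotwistor between `A*^cop` and `H`. -/
theorem homMonoidalEntwining_iff_monoidalHomCotwistor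
    {A H : Type*} [AddCommGroup A] [Module k A] [AddCommGroup H] [Module k H]
    [FiniteDimensional k A]
    {ι : Type*} [Fintype ι] [DecidableEq ι] (b : Module.Basis ι k A)
    (αA : A ≃ₗ[k] A) (μA : A →ₗ[k] A →ₗ[k] A) (eA : A)
    (ΔA : A →ₗ[k] A ⊗[k] A) (εA : A →ₗ[k] k)
    (αH : H ≃ₗ[k] H) (μH : H →ₗ[k] H →ₗ[k] H) (eH : H)
    (ΔH : H →ₗ[k] H ⊗[k] H) (εH : H →ₗ[k] k)
    (hA : IsHomBialgebra k αA μA eA ΔA εA)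
    (hH : IsHomBialgebra k αH μH eH ΔH εH)
    (Φ : H ⊗[k] A →ₗ[k] A ⊗[k] H)
    (hΦ : IsHomEntwining k αA μA eA αH ΔH εH Φ)
    (Δbar : Module.Dual k A →ₗ[k] Module.Dual k A ⊗[k] Module.Dual k A)
    (hΔbar : ∀ (f : Module.Dual k A) (x y : A),
        TensorProduct.dualDistrib k A A (Δbar f) (x ⊗ₜ[k] y)
          = f (αA.symm (αA.symm (μA y x))))
    (star : Module.Dual k A →ₗ[k] Module.Dual k A →ₗ[k] Module.Dual k A)
    (hstar : ∀ (f f' : Module.Dual k A) (y : A),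
        star f f' y = TensorProduct.dualDistrib k A A
          ((f ∘ₗ (αA.symm.toLinearMap ∘ₗ αA.symm.toLinearMap)) ⊗ₜ[k]
            (f' ∘ₗ (αA.symm.toLinearMap ∘ₗ αA.symm.toLinearMap))) (ΔA y))
    (φ : Module.Dual k A ⊗[k] H →ₗ[k] H ⊗[k] Module.Dual k A)
    (hφ : ∀ (f : Module.Dual k A) (h : H),
        φ (f ⊗ₜ[k] h) = ∑ i, (TensorProduct.lid k H
            (TensorProduct.map (f : A →ₗ[k] k) (LinearMap.id : H →ₗ[k] H)
              (Φ (h ⊗ₜ[k] b i)))) ⊗ₜ[k] b.dualBasis i) :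
    IsHomMonoidalEntwining k αA μA eA ΔA εA αH μH eH ΔH εH Φ ↔
      IsMonoidalHomCotwistor k αA.symm.dualMap star (εA : Module.Dual k A)
        Δbar (Module.Dual.eval k A eA) αH μH eH ΔH εH φ := by
  have hT : IsTransposeOf φ Φ := by
    intro f h a
    rw [hφ]
    exact evalRight_sum_dualBasis b (evalLeft f ∘ₗ Φ ∘ₗ TensorProduct.mk k H A h) a
  have hmul := hT.map_mul_iff hΦ.1 hH.1.1 hstar
  have hunit := hT.map_unit_iff εA eH
  exact ⟨fun h => ⟨hT.isHomCotwistor hΦ hΔbar, hmul.1 h.2.1, hunit.1 h.2.2⟩,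
    fun h => ⟨hΦ, hmul.2 h.2.1, hunit.2 h.2.2⟩⟩
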